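/- arXiv:1202.0266 — 3 statements merged into one kernel-verified Lean document; each statement's English description precedes it below -/
import Mathlib

section
/- Let G be a finite reflection group. If g ∈ G satisfies ℓ(a) = codim(a) for every codimension atom a with a ≤_⊥ g, then ℓ(g) = codim(g). -/
open Module

noncomputable section

variable {V : Type*} [AddCommGroup V] [Module ℂ V] [FiniteDimensional ℂ V]

/-- The fixed point space of a linear automorphism. -/
def fixedSpace (g : V ≃ₗ[ℂ] V) : Submodule ℂ V :=
  LinearMap.ker ((g : V →ₗ[ℂ] V) - LinearMap.id)

/-- codim(g) = dim V - dim V^g. -/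
def codim (g : V ≃ₗ[ℂ] V) : ℕ :=
  finrank ℂ V - finrank ℂ (fixedSpace g)

/-- A reflection: a nonidentity element fixing a hyperplane pointwise. -/
def IsReflection (g : V ≃ₗ[ℂ] V) : Prop :=
  g ≠ 1 ∧ finrank ℂ (fixedSpace g) + 1 = finrank ℂ V

/-- Reflection length: minimal number of reflections of `G` whose product is `g`. -/
def reflLength (G : Subgroup (V ≃ₗ[ℂ] V)) (g : G) : ℕ :=
  sInf {k | ∃ l : List G, (∀ s ∈ l, IsReflection (s : V ≃ₗ[ℂ] V)) ∧ l.length = k ∧ l.prod = g}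

/-- `G` is generated by its reflections. -/
def IsGeneratedByReflections (G : Subgroup (V ≃ₗ[ℂ] V)) : Prop :=
  ∀ g : G, ∃ l : List G, (∀ s ∈ l, IsReflection (s : V ≃ₗ[ℂ] V)) ∧ l.prod = g

/-- The codimension order: a ≤⊥ c iff codim(a) + codim(a⁻¹c) = codim(c). -/
def codimLe (G : Subgroup (V ≃ₗ[ℂ] V)) (a c : G) : Prop :=
  codim (a : V ≃ₗ[ℂ] V) + codim ((a⁻¹ * c : G) : V ≃ₗ[ℂ] V) = codim (c : V ≃ₗ[ℂ] V)

/-- An atom of the codimension order: a minimal nonidentity element. -/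
def IsCodimAtom (G : Subgroup (V ≃ₗ[ℂ] V)) (g : G) : Prop :=
  g ≠ 1 ∧ ∀ h : G, h ≠ 1 → h ≠ g → ¬ codimLe G h g

theorem codim_eq_rank (g : V ≃ₗ[ℂ] V) :
    codim g = finrank ℂ (LinearMap.range ((g : V →ₗ[ℂ] V) - LinearMap.id)) := by
  have h := LinearMap.finrank_range_add_finrank_ker ((g : V →ₗ[ℂ] V) - LinearMap.id)
  unfold codim fixedSpace
  omega

theorem codim_one_eq : codim (1 : V ≃ₗ[ℂ] V) = 0 := by
  rw [codim_eq_rank]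
  have : (((1 : V ≃ₗ[ℂ] V) : V →ₗ[ℂ] V) - LinearMap.id) = 0 := by
    ext x; simp
  rw [this]; simp

theorem eq_one_of_codim (g : V ≃ₗ[ℂ] V) (h : codim g = 0) : g = 1 := by
  rw [codim_eq_rank, Submodule.finrank_eq_zero, LinearMap.range_eq_bot] at h
  ext x
  have := LinearMap.congr_fun h x
  simpa [sub_eq_zero] using this

theorem codim_mul_le (a b : V ≃ₗ[ℂ] V) : codim (a * b) ≤ codim a + codim b := by
  simp only [codim_eq_rank]
  refine le_trans (Submodule.finrank_mono (t := LinearMap.range ((a : V →ₗ[ℂ] V) - LinearMap.id) ⊔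
    LinearMap.range ((b : V →ₗ[ℂ] V) - LinearMap.id)) ?_)
    (Submodule.finrank_add_le_finrank_add_finrank _ _)
  rintro _ ⟨x, rfl⟩
  refine Submodule.mem_sup.2 ⟨_, ⟨b x, rfl⟩, _, ⟨x, rfl⟩, ?_⟩
  simp

theorem codim_conj_le (k h : V ≃ₗ[ℂ] V) : codim (k⁻¹ * h * k) ≤ codim h := by
  simp only [codim_eq_rank]
  refine le_trans (Submodule.finrank_mono (t := (LinearMap.range ((h : V →ₗ[ℂ] V) -
    LinearMap.id)).map ((k⁻¹ : V ≃ₗ[ℂ] V) : V →ₗ[ℂ] V)) ?_) (Submodule.finrank_map_le _ _)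
  rintro _ ⟨x, rfl⟩
  refine ⟨_, ⟨k x, rfl⟩, ?_⟩
  have : (k⁻¹ : V ≃ₗ[ℂ] V) (k x) = x := k.symm_apply_apply x
  simp [this]

theorem codim_refl (g : V ≃ₗ[ℂ] V) (h : IsReflection g) : codim g = 1 := by
  have := h.2
  unfold codim
  omega

theorem codimLe_trans_aux (G : Subgroup (V ≃ₗ[ℂ] V)) (a k g : G) (h1 : codimLe G a k)
    (h2 : codimLe G k g) : codimLe G a g := by
  unfold codimLe at *
  have e1 := codim_mul_le ((a⁻¹ * k : G) : V ≃ₗ[ℂ] V) ((k⁻¹ * g : G) : V ≃ₗ[ℂ] V)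
  have e2 := codim_mul_le (a : V ≃ₗ[ℂ] V) ((a⁻¹ * g : G) : V ≃ₗ[ℂ] V)
  rw [← Subgroup.coe_mul] at e1 e2
  rw [show a⁻¹ * k * (k⁻¹ * g) = a⁻¹ * g by group] at e1
  rw [show a * (a⁻¹ * g) = g by group] at e2
  omega

theorem codimLe_right (G : Subgroup (V ≃ₗ[ℂ] V)) (h g : G) (h1 : codimLe G h g) :
    codimLe G (h⁻¹ * g) g := by
  unfold codimLe at *
  have e1 := codim_conj_le ((h⁻¹ * g : G) : V ≃ₗ[ℂ] V) (h : V ≃ₗ[ℂ] V)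
  have e2 := codim_mul_le ((h⁻¹ * g : G) : V ≃ₗ[ℂ] V) (((h⁻¹ * g)⁻¹ * g : G) : V ≃ₗ[ℂ] V)
  rw [← Subgroup.coe_inv, ← Subgroup.coe_mul, ← Subgroup.coe_mul] at e1
  rw [← Subgroup.coe_mul] at e2
  rw [show (h⁻¹ * g)⁻¹ * h * (h⁻¹ * g) = (h⁻¹ * g)⁻¹ * g by group] at e1
  rw [show (h⁻¹ * g) * ((h⁻¹ * g)⁻¹ * g) = g by group] at e2
  omega

theorem codim_le_length (G : Subgroup (V ≃ₗ[ℂ] V)) (l : List G)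
    (hl : ∀ s ∈ l, IsReflection (s : V ≃ₗ[ℂ] V)) :
    codim (l.prod : V ≃ₗ[ℂ] V) ≤ l.length := by
  induction l with
  | nil => simp [codim_one_eq]
  | cons s l ih =>
    have h1 := ih (fun t ht => hl t (List.mem_cons_of_mem _ ht))
    have h2 := codim_refl _ (hl s List.mem_cons_self)
    have h3 := codim_mul_le (s : V ≃ₗ[ℂ] V) (l.prod : V ≃ₗ[ℂ] V)
    rw [List.prod_cons, Subgroup.coe_mul, List.length_cons]
    omega

theorem reflLength_spec (G : Subgroup (V ≃ₗ[ℂ] V)) (hG : IsGeneratedByReflections G) (g : G) :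
    ∃ l : List G, (∀ s ∈ l, IsReflection (s : V ≃ₗ[ℂ] V)) ∧ l.length = reflLength G g ∧
      l.prod = g := by
  obtain ⟨l, h1, h2⟩ := hG g
  exact Nat.sInf_mem (s := {k | ∃ l : List G, (∀ s ∈ l, IsReflection (s : V ≃ₗ[ℂ] V)) ∧
    l.length = k ∧ l.prod = g}) ⟨l.length, l, h1, rfl, h2⟩

theorem reflLength_main (G : Subgroup (V ≃ₗ[ℂ] V))
    (hG : IsGeneratedByReflections G) (n : ℕ) : ∀ (g : G), codim (g : V ≃ₗ[ℂ] V) = n →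
    (∀ a : G, IsCodimAtom G a → codimLe G a g →
      reflLength G a = codim (a : V ≃ₗ[ℂ] V)) →
    reflLength G g = codim (g : V ≃ₗ[ℂ] V) := by
  induction n using Nat.strong_induction_on with
  | _ n ih =>
  intro g hn hatoms
  have one_of : ∀ x : G, codim (x : V ≃ₗ[ℂ] V) = 0 → x = 1 := fun x hx =>
    Subtype.ext (eq_one_of_codim _ hx)
  have lower : codim (g : V ≃ₗ[ℂ] V) ≤ reflLength G g := by
    obtain ⟨l, h1, h2, h3⟩ := reflLength_spec G hG g
    have := codim_le_length G l h1
    rw [h3, h2] at this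
    exact this
  refine le_antisymm ?_ lower
  by_cases hg1 : g = 1
  · exact Nat.sInf_le ⟨[], by simp, by simp [hg1, codim_one_eq], by simp [hg1]⟩
  by_cases hat : IsCodimAtom G g
  · exact (hatoms g hat (by simp [codimLe, codim_one_eq])).le
  · have : ∃ h : G, h ≠ 1 ∧ h ≠ g ∧ codimLe G h g := by
      by_contra hc
      exact hat ⟨hg1, fun h a b c => hc ⟨h, a, b, c⟩⟩
    obtain ⟨h, hh1, hhg, hle⟩ := this
    have hsum := hle
    unfold codimLe at hsum
    have p1 : codim (h : V ≃ₗ[ℂ] V) ≠ 0 := fun h0 => hh1 (one_of _ h0)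
    have p2 : codim ((h⁻¹ * g : G) : V ≃ₗ[ℂ] V) ≠ 0 := fun h0 =>
      hhg (inv_mul_eq_one.1 (one_of _ h0))
    have r1 := ih _ (by omega) h rfl
      (fun a ha hl => hatoms a ha (codimLe_trans_aux G _ _ _ hl hle))
    have r2 := ih _ (by omega) (h⁻¹ * g) rfl
      (fun a ha hl => hatoms a ha (codimLe_trans_aux G _ _ _ hl (codimLe_right G _ _ hle)))
    obtain ⟨l, h1, h2, h3⟩ := reflLength_spec G hG h
    obtain ⟨m, k1, k2, k3⟩ := reflLength_spec G hG (h⁻¹ * g)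
    refine Nat.sInf_le ⟨l ++ m, ?_, ?_, ?_⟩
    · intro s hs
      rcases List.mem_append.1 hs with hs | hs
      · exact h1 s hs
      · exact k1 s hs
    · rw [List.length_append]; omega
    · rw [List.prod_append, h3, k3]; group

theorem reflLength_eq_codim_of_atoms (G : Subgroup (V ≃ₗ[ℂ] V)) [Finite G]
    (hG : IsGeneratedByReflections G) (g : G)
    (hatoms : ∀ a : G, IsCodimAtom G a → codimLe G a g →
      reflLength G a = codim (a : V ≃ₗ[ℂ] V)) :
    reflLength G g = codim (g : V ≃ₗ[ℂ] V) := by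
  exact reflLength_main G hG _ g rfl hatoms
end
end

section
/- Let G be an irreducible complex reflection group acting on V ≅ ℂ², and let z ∈ G be a nonidentity central element. If z = st for reflections s, t ∈ G, then s and t commute and both have the same order as z. -/
open Module

noncomputable section

variable {V : Type*} [AddCommGroup V] [Module ℂ V] [FiniteDimensional ℂ V]

/-- G acts irreducibly on V. -/
def IsIrreducibleAction (G : Subgroup (V ≃ₗ[ℂ] V)) : Prop :=
  ∀ W : Submodule ℂ V, (∀ g : G, ∀ v ∈ W, (g : V ≃ₗ[ℂ] V) v ∈ W) → W = ⊥ ∨ W = ⊤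

theorem aux_mem_fixed (g : V ≃ₗ[ℂ] V) (v : V) : v ∈ fixedSpace g ↔ g v = v := by
  simp [fixedSpace, sub_eq_zero]

theorem aux_pow_fix (g : V ≃ₗ[ℂ] V) (v : V) (h : g v = v) (n : ℕ) : (g ^ n) v = v := by
  induction n with
  | zero => simp
  | succ k ih => rw [pow_succ, LinearEquiv.mul_apply, h, ih]

theorem aux_central (G : Subgroup (V ≃ₗ[ℂ] V)) (hirr : IsIrreducibleAction G)
    (w : G) (hw : w ∈ Subgroup.center G) (v : V) (hv : v ≠ 0)
    (h : (w : V ≃ₗ[ℂ] V) v = v) : w = 1 := by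
  rcases hirr (fixedSpace (w : V ≃ₗ[ℂ] V)) (by
    intro g x hx
    rw [aux_mem_fixed] at hx ⊢
    have hc : g * w = w * g := Subgroup.mem_center_iff.mp hw g
    have hc2 : (g : V ≃ₗ[ℂ] V) * (w : V ≃ₗ[ℂ] V) = (w : V ≃ₗ[ℂ] V) * (g : V ≃ₗ[ℂ] V) :=
      congrArg Subtype.val hc
    have hc3 := congrArg (fun f : V ≃ₗ[ℂ] V => f x) hc2
    simp only [LinearEquiv.mul_apply, hx] at hc3
    exact hc3.symm) with h0 | h0
  · have := (aux_mem_fixed (w : V ≃ₗ[ℂ] V) v).2 h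
    rw [h0] at this
    exact absurd ((Submodule.mem_bot ℂ).1 this) hv
  · apply Subtype.ext
    apply LinearEquiv.ext
    intro x
    have : x ∈ fixedSpace (w : V ≃ₗ[ℂ] V) := by rw [h0]; trivial
    exact (aux_mem_fixed _ _).1 this

theorem aux_order (hdim : finrank ℂ V = 2)
    (G : Subgroup (V ≃ₗ[ℂ] V)) (hirr : IsIrreducibleAction G)
    (z s t : G) (hz : z ∈ Subgroup.center G) (hz1 : z ≠ 1)
    (hs : IsReflection (s : V ≃ₗ[ℂ] V)) (ht : IsReflection (t : V ≃ₗ[ℂ] V))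
    (hst : z = s * t) (hc : Commute s t) : orderOf s = orderOf z := by
  have hs1 : finrank ℂ (fixedSpace (s : V ≃ₗ[ℂ] V)) = 1 := by have := hs.2; omega
  have ht1 : finrank ℂ (fixedSpace (t : V ≃ₗ[ℂ] V)) = 1 := by have := ht.2; omega
  have hzn : ∀ n : ℕ, z ^ n = s ^ n * t ^ n := fun n => by rw [hst, hc.mul_pow]
  rw [orderOf_eq_orderOf_iff]
  intro n
  constructor
  · intro h
    have hpos : 0 < finrank ℂ (fixedSpace (t : V ≃ₗ[ℂ] V)) := by omega
    obtain ⟨⟨u, hu⟩, hu0⟩ := Module.finrank_pos_iff_exists_ne_zero.1 hpos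
    refine aux_central G hirr (z ^ n) (Subgroup.pow_mem _ hz n) u
      (fun h => hu0 (Subtype.ext h)) ?_
    rw [hzn, h, one_mul]
    exact aux_pow_fix _ _ ((aux_mem_fixed _ _).1 hu) n
  · intro h
    have hdisj : Disjoint (fixedSpace (s : V ≃ₗ[ℂ] V)) (fixedSpace (t : V ≃ₗ[ℂ] V)) := by
      rw [Submodule.disjoint_def]
      intro x hx hx2
      rw [aux_mem_fixed] at hx hx2
      by_contra hx0
      apply hz1
      refine aux_central G hirr z hz x hx0 ?_
      rw [hst]
      change (s : V ≃ₗ[ℂ] V) ((t : V ≃ₗ[ℂ] V) x) = x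
      rw [hx2, hx]
    have htop := Submodule.eq_top_of_disjoint _ _ (by rw [hs1, ht1, hdim]) hdisj
    have hsn : t ^ n = (s ^ n)⁻¹ := by
      rw [eq_inv_iff_mul_eq_one, ← (hc.pow_pow n n).eq, ← hzn, h]
    have hle : fixedSpace (s : V ≃ₗ[ℂ] V) ⊔ fixedSpace (t : V ≃ₗ[ℂ] V)
        ≤ fixedSpace ((s ^ n : G) : V ≃ₗ[ℂ] V) := by
      apply sup_le
      · intro x hx
        rw [aux_mem_fixed] at hx ⊢
        exact aux_pow_fix _ _ hx n
      · intro x hx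
        rw [aux_mem_fixed] at hx ⊢
        have h1 : ((t ^ n : G) : V ≃ₗ[ℂ] V) x = x := aux_pow_fix _ _ hx n
        have h2 : ((s ^ n * t ^ n : G) : V ≃ₗ[ℂ] V) x = x := by
          rw [← hzn, h]; rfl
        have h3 : ((s ^ n : G) : V ≃ₗ[ℂ] V) (((t ^ n : G) : V ≃ₗ[ℂ] V) x) = x := h2
        rwa [h1] at h3
    apply Subtype.ext
    apply LinearEquiv.ext
    intro x
    exact (aux_mem_fixed _ _).1 (hle (by rw [htop]; trivial))

theorem central_product_of_reflections (hdim : finrank ℂ V = 2)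
    (G : Subgroup (V ≃ₗ[ℂ] V)) [Finite G]
    (hG : IsGeneratedByReflections G) (hirr : IsIrreducibleAction G)
    (z s t : G) (hz : z ∈ Subgroup.center G) (hz1 : z ≠ 1)
    (hs : IsReflection (s : V ≃ₗ[ℂ] V)) (ht : IsReflection (t : V ≃ₗ[ℂ] V))
    (hst : z = s * t) :
    s * t = t * s ∧ orderOf s = orderOf z ∧ orderOf t = orderOf z := by
  have hc : s * t = t * s := by
    have h := Subgroup.mem_center_iff.mp hz s
    rw [hst, mul_assoc] at h
    exact mul_left_cancel h
  exact ⟨hc, aux_order hdim G hirr z s t hz hz1 hs ht hst hc,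
    aux_order hdim G hirr z t s hz hz1 ht hs (hst.trans hc) hc.symm⟩
end
end

section
/- Let G be an irreducible complex reflection group acting on V ≅ ℂ² and z ∈ G a nonidentity central element. If G contains no reflection whose order equals the order of z, then ℓ(z) > codim(z), i.e., ℓ(z) ≥ 3 while codim(z) = 2. -/
open Module

noncomputable section

variable {V : Type*} [AddCommGroup V] [Module ℂ V] [FiniteDimensional ℂ V]

theorem central_length_exceeds_codim (hdim : finrank ℂ V = 2)
    (G : Subgroup (V ≃ₗ[ℂ] V)) [Finite G]
    (hG : IsGeneratedByReflections G) (hirr : IsIrreducibleAction G)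
    (z : G) (hz : z ∈ Subgroup.center G) (hz1 : z ≠ 1)
    (hnoref : ∀ s : G, IsReflection (s : V ≃ₗ[ℂ] V) → orderOf s ≠ orderOf z) :
    codim (z : V ≃ₗ[ℂ] V) = 2 ∧ 3 ≤ reflLength G z := by
  classical
  have hfix : ∀ (g : V ≃ₗ[ℂ] V) (v : V), v ∈ fixedSpace g ↔ g v = v := by
    intro g v
    simp [fixedSpace, sub_eq_zero]
  have hcomm : ∀ (g : G) (v : V), (z : V ≃ₗ[ℂ] V) ((g : V ≃ₗ[ℂ] V) v)
      = (g : V ≃ₗ[ℂ] V) ((z : V ≃ₗ[ℂ] V) v) := by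
    intro g v
    have h := Subgroup.mem_center_iff.mp hz g
    have h2 := congrArg (fun x : G => (x : V ≃ₗ[ℂ] V) v) h
    simpa using h2.symm
  have hbot : fixedSpace (z : V ≃ₗ[ℂ] V) = ⊥ := by
    rcases hirr (fixedSpace (z : V ≃ₗ[ℂ] V)) (by
      intro g v hv
      rw [hfix] at hv ⊢
      rw [hcomm, hv]) with h | h
    · exact h
    · exfalso
      apply hz1
      apply Subtype.ext
      apply LinearEquiv.ext
      intro v
      have : v ∈ fixedSpace (z : V ≃ₗ[ℂ] V) := by rw [h]; trivial
      simpa using (hfix _ _).mp this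
  haveI : Nontrivial V := Module.nontrivial_of_finrank_pos (R := ℂ) (by omega)
  obtain ⟨c, hc⟩ : ∃ c : ℂ, ∀ v : V, (z : V ≃ₗ[ℂ] V) v = c • v := by
    obtain ⟨c, hc⟩ := Module.End.exists_eigenvalue ((z : V ≃ₗ[ℂ] V) : V →ₗ[ℂ] V)
    refine ⟨c, ?_⟩
    rcases hirr (Module.End.eigenspace ((z : V ≃ₗ[ℂ] V) : V →ₗ[ℂ] V) c) (by
      intro g v hv
      rw [Module.End.mem_eigenspace_iff] at hv ⊢
      have hv' : (z : V ≃ₗ[ℂ] V) v = c • v := hv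
      change (z : V ≃ₗ[ℂ] V) _ = _
      rw [hcomm, hv', map_smul]) with h | h
    · exact absurd h hc
    · intro v
      have : v ∈ Module.End.eigenspace ((z : V ≃ₗ[ℂ] V) : V →ₗ[ℂ] V) c := by
        rw [h]; trivial
      exact Module.End.mem_eigenspace_iff.mp this
  have hc1 : c ≠ 1 := by
    rintro rfl
    apply hz1
    apply Subtype.ext
    apply LinearEquiv.ext
    intro v
    simpa using hc v
  refine ⟨by unfold codim; rw [hbot, finrank_bot, hdim], ?_⟩
  have hexv : ∀ g : V ≃ₗ[ℂ] V, IsReflection g → ∃ v : V, v ≠ 0 ∧ g v = v := by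
    intro g hg
    have h1 : 0 < finrank ℂ (fixedSpace g) := by
      have := hg.2
      omega
    haveI := Module.nontrivial_of_finrank_pos (R := ℂ) h1
    obtain ⟨v, hv⟩ := exists_ne (0 : fixedSpace g)
    exact ⟨v, fun h => hv (Subtype.ext h), (hfix _ _).mp v.2⟩
  obtain ⟨l0, hl0, hl0z⟩ := hG z
  refine le_csInf ⟨l0.length, l0, hl0, rfl, hl0z⟩ ?_
  rintro k ⟨l, hl, rfl, hprod⟩
  match l, hl, hprod with
  | [], _, hprod => exact absurd hprod.symm (by simpa using hz1)
  | [s], hl, hprod =>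
    have hs : s = z := by simpa using hprod
    exact absurd (by rw [hs]) (hnoref s (hl s (by simp)))
  | [s, t], hl, hprod =>
    exfalso
    have hst : s * t = z := by simpa using hprod
    have ht := hl t (by simp)
    obtain ⟨v, hv0, hv⟩ := hexv _ (hl s (by simp))
    obtain ⟨w, hw0, hw⟩ := hexv _ ht
    have htv : (t : V ≃ₗ[ℂ] V) v = c • v := by
      apply (s : V ≃ₗ[ℂ] V).injective
      have h2 := congrArg (fun x : G => (x : V ≃ₗ[ℂ] V) v) hst
      have h3 : (s : V ≃ₗ[ℂ] V) ((t : V ≃ₗ[ℂ] V) v) = (z : V ≃ₗ[ℂ] V) v := by simpa using h2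
      rw [h3, hc, map_smul, hv]
    have htn : ∀ n : ℕ, ((t ^ n : G) : V ≃ₗ[ℂ] V) v = c ^ n • v := by
      intro n
      induction n with
      | zero => simp
      | succ n ih =>
        have : ((t ^ (n+1) : G) : V ≃ₗ[ℂ] V) v
          = ((t ^ n : G) : V ≃ₗ[ℂ] V) ((t : V ≃ₗ[ℂ] V) v) := by
          rw [pow_succ]; rfl
        rw [this, htv, map_smul, ih, smul_smul, pow_succ']
    have htw : ∀ n : ℕ, ((t ^ n : G) : V ≃ₗ[ℂ] V) w = w := by
      intro n
      induction n with
      | zero => simp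
      | succ n ih =>
        have : ((t ^ (n+1) : G) : V ≃ₗ[ℂ] V) w
          = ((t ^ n : G) : V ≃ₗ[ℂ] V) ((t : V ≃ₗ[ℂ] V) w) := by
          rw [pow_succ]; rfl
        rw [this, hw, ih]
    have hzn : ∀ (n : ℕ) (u : V), ((z ^ n : G) : V ≃ₗ[ℂ] V) u = c ^ n • u := by
      intro n
      induction n with
      | zero => simp
      | succ n ih =>
        intro u
        have : ((z ^ (n+1) : G) : V ≃ₗ[ℂ] V) u
          = ((z ^ n : G) : V ≃ₗ[ℂ] V) ((z : V ≃ₗ[ℂ] V) u) := by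
          rw [pow_succ]; rfl
        rw [this, hc, map_smul, ih, smul_smul, pow_succ']
    have hli : LinearIndependent ℂ ![v, w] := by
      rw [LinearIndependent.pair_iff]
      intro a b hab
      have h1 := congrArg (t : V ≃ₗ[ℂ] V) hab
      rw [map_add, map_smul, map_smul, htv, hw, map_zero] at h1
      have h2 : (a * (c - 1)) • v = 0 := by
        have : (a * (c - 1)) • v = (a • c • v + b • w) - (a • v + b • w) := by module
        rw [this, h1, hab, sub_zero]
      have ha : a = 0 := by
        rcases smul_eq_zero.mp h2 with h | h
        · exact (mul_eq_zero.mp h).resolve_right (sub_ne_zero.mpr hc1)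
        · exact absurd h hv0
      refine ⟨ha, ?_⟩
      rw [ha, zero_smul, zero_add] at hab
      exact (smul_eq_zero.mp hab).resolve_right hw0
    have hspan := hli.span_eq_top_of_card_eq_finrank (by simp [hdim])
    apply hnoref t ht
    rw [orderOf_eq_orderOf_iff]
    intro n
    constructor
    · intro h
      have h1 := htn n
      rw [h] at h1
      have h2 : c ^ n = 1 := by
        have h3 : (c ^ n - 1) • v = 0 := by
          rw [sub_smul, ← h1]; simp
        exact sub_eq_zero.mp ((smul_eq_zero.mp h3).resolve_right hv0)
      apply Subtype.ext
      apply LinearEquiv.ext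
      intro u
      rw [hzn, h2]; simp
    · intro h
      have h1 := hzn n v
      rw [h] at h1
      have h2 := htn n
      rw [← h1] at h2
      apply Subtype.ext
      apply LinearEquiv.toLinearMap_injective
      apply LinearMap.ext_on hspan
      rintro x ⟨i, rfl⟩
      fin_cases i
      · exact h2
      · exact htw n
  | _ :: _ :: _ :: _, _, _ => simp
end
end
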